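/- Any formula of FOC[+;MOD] of the form φ = ∃^{=x} p. ⋁_{i=1}^l φ_i is equivalent to a formula φ' = ∃x_1. … ∃x_m. (⋀_{j=1}^m ∃^{=x_j} p. ψ_j ∧ χ), where x_1,…,x_m are fresh count variables, each ψ_j is a conjunction of a subset of the formulas φ_1,…,φ_l, and χ has no free position variables. -/

import Mathlib

namespace FOC

/-- Count terms: affine combinations `c₀ + c₁·x₁ + ⋯ + cₖ·xₖ` with rational
coefficients over count variables (named by naturals). -/
structure CTerm where
  const : ℚ
  coeffs : List (ℚ × ℕ)

/-- Evaluate a count term under a count-variable assignment. -/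
def CTerm.eval (t : CTerm) (ν : ℕ → ℚ) : ℚ :=
  t.const + (t.coeffs.map fun c => c.1 * ν c.2).sum

/-- The count variables occurring in a count term. -/
def CTerm.vars (t : CTerm) : Finset ℕ :=
  (t.coeffs.map Prod.snd).toFinset

/-- The count term consisting of a single variable. -/
def CTerm.var (x : ℕ) : CTerm := ⟨0, [(1, x)]⟩

/-- A constant count term. -/
def CTerm.cst (c : ℚ) : CTerm := ⟨c, []⟩

/-- Formulas of FOC[+;MOD] over the alphabet `A`.  Position variables and
count variables are both named by naturals (the two sorts are separate). -/
inductive Formula (A : Type) : Type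
  | tru : Formula A
  | fls : Formula A
  | qa (a : A) (p : ℕ) : Formula A
  | mod (r m : ℕ) (p : ℕ) : Formula A
  | eq (t₁ t₂ : CTerm) : Formula A
  | lt (t₁ t₂ : CTerm) : Formula A
  | and (φ ψ : Formula A) : Formula A
  | or (φ ψ : Formula A) : Formula A
  | not (φ : Formula A) : Formula A
  | exC (x : ℕ) (φ : Formula A) : Formula A
  | allC (x : ℕ) (φ : Formula A) : Formula A
  | cnt (x : ℕ) (p : ℕ) (φ : Formula A) : Formula A

variable {A : Type}

open Classical in
/-- Satisfaction of a formula in a string `w` (positions are `1,…,w.length`;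
the letter at position `p` is `w[p-1]`), under a position assignment `ρ` and a
count assignment `ν`.  The counting quantifier `cnt x p φ` holds iff the number
of positions `j ∈ [1, w.length]` satisfying `φ` equals `ν x`. -/
def Sat (w : List A) : (ℕ → ℕ) → (ℕ → ℚ) → Formula A → Prop
  | _, _, .tru => True
  | _, _, .fls => False
  | ρ, _, .qa a p => w[ρ p - 1]? = some a
  | ρ, _, .mod r m p => ρ p % m = r % m
  | _, ν, .eq t₁ t₂ => t₁.eval ν = t₂.eval ν
  | _, ν, .lt t₁ t₂ => t₁.eval ν < t₂.eval ν
  | ρ, ν, .and φ ψ => Sat w ρ ν φ ∧ Sat w ρ ν ψ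
  | ρ, ν, .or φ ψ => Sat w ρ ν φ ∨ Sat w ρ ν ψ
  | ρ, ν, .not φ => ¬ Sat w ρ ν φ
  | ρ, ν, .exC x φ => ∃ q : ℚ, Sat w ρ (Function.update ν x q) φ
  | ρ, ν, .allC x φ => ∀ q : ℚ, Sat w ρ (Function.update ν x q) φ
  | ρ, ν, .cnt x p φ =>
      (((Finset.Icc 1 w.length).filter
          (fun j => Sat w (Function.update ρ p j) ν φ)).card : ℚ) = ν x

/-- Free position variables of a formula. -/
def freePos : Formula A → Finset ℕ
  | .tru => ∅
  | .fls => ∅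
  | .qa _ p => {p}
  | .mod _ _ p => {p}
  | .eq _ _ => ∅
  | .lt _ _ => ∅
  | .and φ ψ => freePos φ ∪ freePos ψ
  | .or φ ψ => freePos φ ∪ freePos ψ
  | .not φ => freePos φ
  | .exC _ φ => freePos φ
  | .allC _ φ => freePos φ
  | .cnt _ p φ => freePos φ \ {p}

/-- Free count variables of a formula. -/
def freeCount : Formula A → Finset ℕ
  | .tru => ∅
  | .fls => ∅
  | .qa _ _ => ∅
  | .mod _ _ _ => ∅
  | .eq t₁ t₂ => t₁.vars ∪ t₂.vars
  | .lt t₁ t₂ => t₁.vars ∪ t₂.vars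
  | .and φ ψ => freeCount φ ∪ freeCount ψ
  | .or φ ψ => freeCount φ ∪ freeCount ψ
  | .not φ => freeCount φ
  | .exC x φ => freeCount φ \ {x}
  | .allC x φ => freeCount φ \ {x}
  | .cnt x _ φ => freeCount φ ∪ {x}

/-- Quantifier-free formulas (no `∃x`, `∀x`, and no counting quantifier). -/
def QFree : Formula A → Prop
  | .and φ ψ => QFree φ ∧ QFree ψ
  | .or φ ψ => QFree φ ∧ QFree ψ
  | .not φ => QFree φ
  | .exC _ _ => False
  | .allC _ _ => False
  | .cnt _ _ _ => False
  | _ => True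

/-- Two formulas are equivalent if they have the same truth value in every
string under every assignment of the (position and count) variables. -/
def FOCEquiv (φ ψ : Formula A) : Prop :=
  ∀ (w : List A) (ρ : ℕ → ℕ) (ν : ℕ → ℚ), Sat w ρ ν φ ↔ Sat w ρ ν ψ

/-- A sentence is a formula without free variables. -/
def IsSentence (φ : Formula A) : Prop := freePos φ = ∅ ∧ freeCount φ = ∅

/-- The language defined by a sentence. -/
def Defines (σ : Formula A) (L : Set (List A)) : Prop :=
  ∀ w, w ∈ L ↔ Sat w (fun _ => 1) (fun _ => 0) σ

/-- Finite conjunction. -/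
def bigAnd (l : List (Formula A)) : Formula A := l.foldr .and .tru

/-- Finite disjunction. -/
def bigOr (l : List (Formula A)) : Formula A := l.foldr .or .fls

/-- Iterated existential count quantification `∃x₁.…∃xₖ. φ`. -/
def exCs (xs : List ℕ) (φ : Formula A) : Formula A := xs.foldr .exC φ

end FOC

namespace FOC

variable {A : Type}

theorem sat_congr_of_freeCount (w : List A) (φ : Formula A) (ρ : ℕ → ℕ) (ν ν' : ℕ → ℚ)
    (h : ∀ y ∈ freeCount φ, ν y = ν' y) : Sat w ρ ν φ ↔ Sat w ρ ν' φ := by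
  have eval_congr (t : CTerm) {ν ν' : ℕ → ℚ} (h : ∀ y ∈ t.vars, ν y = ν' y) :
      t.eval ν = t.eval ν' := by
    unfold CTerm.eval
    congr 2
    refine List.map_congr_left fun c hc => ?_
    rw [h c.2 (by simpa [CTerm.vars] using ⟨c.1, hc⟩)]
  have update_congr (s : Finset ℕ) (x : ℕ) (q : ℚ) {ν ν' : ℕ → ℚ}
      (h : ∀ y ∈ s \ {x}, ν y = ν' y) :
      ∀ y ∈ s, Function.update ν x q y = Function.update ν' x q y := by
    intro y hy
    by_cases hyx : y = x
    · simp [hyx]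
    · simpa [hyx] using h y (by simp [hy, hyx])
  induction φ generalizing ρ ν ν' with
  | tru => rfl
  | fls => rfl
  | qa a p => rfl
  | mod r m p => rfl
  | eq t₁ t₂ =>
    simp only [Sat]
    rw [eval_congr t₁ fun y hy => h y (Finset.mem_union_left _ hy),
      eval_congr t₂ fun y hy => h y (Finset.mem_union_right _ hy)]
  | lt t₁ t₂ =>
    simp only [Sat]
    rw [eval_congr t₁ fun y hy => h y (Finset.mem_union_left _ hy),
      eval_congr t₂ fun y hy => h y (Finset.mem_union_right _ hy)]
  | and φ ψ ihφ ihψ =>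
    exact and_congr (ihφ ρ ν ν' fun y hy => h y (Finset.mem_union_left _ hy))
      (ihψ ρ ν ν' fun y hy => h y (Finset.mem_union_right _ hy))
  | or φ ψ ihφ ihψ =>
    exact or_congr (ihφ ρ ν ν' fun y hy => h y (Finset.mem_union_left _ hy))
      (ihψ ρ ν ν' fun y hy => h y (Finset.mem_union_right _ hy))
  | not φ ih => exact not_congr (ih ρ ν ν' h)
  | exC x φ ih => exact exists_congr fun q => ih ρ _ _ (update_congr _ x q h)
  | allC x φ ih => exact forall_congr' fun q => ih ρ _ _ (update_congr _ x q h)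
  | cnt x p φ ih =>
    simp only [Sat]
    rw [h x (Finset.mem_union_right _ (Finset.mem_singleton_self x))]
    classical
    rw [Finset.filter_congr fun j _ => ih _ ν ν' fun y hy => h y (Finset.mem_union_left _ hy)]

theorem sat_bigAnd (w : List A) (ρ : ℕ → ℕ) (ν : ℕ → ℚ) (l : List (Formula A)) :
    Sat w ρ ν (bigAnd l) ↔ ∀ φ ∈ l, Sat w ρ ν φ := by
  induction l with
  | nil => simp [bigAnd, Sat]
  | cons a l ih =>
    rw [List.forall_mem_cons, ← ih]
    rfl

theorem freeCount_bigAnd_subset {l φs : List (Formula A)} (h : l.Sublist φs) :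
    freeCount (bigAnd l) ⊆ freeCount (bigOr φs) := by
  induction h with
  | slnil => exact Finset.Subset.refl _
  | cons a _ ih => exact ih.trans Finset.subset_union_right
  | cons_cons a _ ih => exact Finset.union_subset_union_right ih

theorem sat_exCs (w : List A) (ρ : ℕ → ℕ) (ν : ℕ → ℚ) (xs : List ℕ) (φ : Formula A) :
    Sat w ρ ν (exCs xs φ) ↔ ∃ ν' : ℕ → ℚ, (∀ y ∉ xs, ν' y = ν y) ∧ Sat w ρ ν' φ := by
  induction xs generalizing ν with
  | nil =>
    constructor
    · exact fun h => ⟨ν, fun _ _ => rfl, h⟩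
    · rintro ⟨ν', h, hs⟩
      rwa [← funext fun y => h y (List.not_mem_nil)]
  | cons x xs ih =>
    have unfold_cons : Sat w ρ ν (exCs (x :: xs) φ) ↔
        ∃ q : ℚ, Sat w ρ (Function.update ν x q) (exCs xs φ) := Iff.rfl
    simp only [unfold_cons, ih]
    constructor
    · rintro ⟨q, ν', h, hs⟩
      refine ⟨ν', fun y hy => ?_, hs⟩
      rw [List.mem_cons, not_or] at hy
      rw [h y hy.2, Function.update_of_ne hy.1]
    · rintro ⟨ν', h, hs⟩
      refine ⟨ν' x, ν', fun y hy => ?_, hs⟩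
      by_cases hyx : y = x
      · simp [hyx]
      · rw [Function.update_of_ne hyx, h y (by simp [hyx, hy])]

open Classical in
/-- The number of positions of `w`, ranged over by `p`, that satisfy `φ`. -/
noncomputable def positionCount (w : List A) (ρ : ℕ → ℕ) (ν : ℕ → ℚ) (p : ℕ) (φ : Formula A) : ℚ :=
  (((Finset.Icc 1 w.length).filter (fun j => Sat w (Function.update ρ p j) ν φ)).card : ℚ)

theorem sat_cnt (w : List A) (ρ : ℕ → ℕ) (ν : ℕ → ℚ) (x p : ℕ) (φ : Formula A) :
    Sat w ρ ν (.cnt x p φ) ↔ positionCount w ρ ν p φ = ν x := Iff.rfl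

theorem positionCount_congr (w : List A) (ρ : ℕ → ℕ) (p : ℕ) (φ : Formula A) {ν ν' : ℕ → ℚ}
    (h : ∀ y ∈ freeCount φ, ν y = ν' y) :
    positionCount w ρ ν p φ = positionCount w ρ ν' p φ := by
  classical
  unfold positionCount
  rw [Finset.filter_congr fun j _ => sat_congr_of_freeCount w φ _ ν ν' h]

/-- The signed sublists in the inclusion-exclusion expansion `1 - ∏ (1 - φᵢ)` of `⋁ φᵢ`. -/
def inclusionExclusion (φs : List (Formula A)) : List (ℚ × List (Formula A)) :=
  (1, []) :: φs.sublists'.map fun l => (-(-1) ^ l.length, l)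

theorem sublist_of_mem_inclusionExclusion {φs : List (Formula A)} {k : ℚ × List (Formula A)}
    (hk : k ∈ inclusionExclusion φs) : k.2.Sublist φs := by
  rcases List.mem_cons.1 hk with rfl | hk
  · exact List.nil_sublist φs
  · obtain ⟨l, hl, rfl⟩ := List.mem_map.1 hk
    exact List.mem_sublists'.1 hl

open Classical in
theorem indicator_bigOr (w : List A) (ρ : ℕ → ℕ) (ν : ℕ → ℚ) (φs : List (Formula A)) :
    (if Sat w ρ ν (bigOr φs) then 1 else 0 : ℚ) =
      ((inclusionExclusion φs).map fun k =>
        k.1 * if Sat w ρ ν (bigAnd k.2) then 1 else 0).sum := by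
  have signed_sum : ((φs.sublists'.map fun l =>
      -(-1 : ℚ) ^ l.length * if Sat w ρ ν (bigAnd l) then 1 else 0)).sum =
        -(if Sat w ρ ν (bigOr φs) then 0 else 1) := by
    induction φs with
    | nil => simp [bigAnd, bigOr, Sat]
    | cons a φs ih =>
      have and_cons (l : List (Formula A)) :
          Sat w ρ ν (bigAnd (a :: l)) ↔ Sat w ρ ν a ∧ Sat w ρ ν (bigAnd l) := Iff.rfl
      have or_cons : Sat w ρ ν (bigOr (a :: φs)) ↔ Sat w ρ ν a ∨ Sat w ρ ν (bigOr φs) := Iff.rfl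
      simp only [List.sublists'_cons, List.map_append, List.map_map, List.sum_append, ih]
      by_cases ha : Sat w ρ ν a
      · have flip : ((fun l : List (Formula A) =>
            -(-1 : ℚ) ^ l.length * if Sat w ρ ν (bigAnd l) then 1 else 0) ∘ List.cons a) =
            fun l => -1 * (-(-1 : ℚ) ^ l.length * if Sat w ρ ν (bigAnd l) then 1 else 0) := by
          funext l
          simp only [Function.comp_apply, and_cons, ha, true_and, List.length_cons, pow_succ]
          ring
        rw [flip, List.sum_map_mul_left, ih]
        simp only [or_cons, ha, true_or, if_true]
        ring
      · have vanish : ((fun l : List (Formula A) =>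
            -(-1 : ℚ) ^ l.length * if Sat w ρ ν (bigAnd l) then 1 else 0) ∘ List.cons a) =
            fun _ => 0 := by
          funext l
          simp [and_cons, ha]
        rw [vanish]
        simp [or_cons, ha]
  simp only [inclusionExclusion, List.map_cons, List.map_map, List.sum_cons, Function.comp_def,
    signed_sum]
  by_cases h : Sat w ρ ν (bigOr φs) <;> simp [h, bigAnd, Sat]

theorem positionCount_bigOr (w : List A) (ρ : ℕ → ℕ) (ν : ℕ → ℚ) (p : ℕ)
    (φs : List (Formula A)) :
    positionCount w ρ ν p (bigOr φs) = ∑ j : Fin (inclusionExclusion φs).length,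
      (inclusionExclusion φs)[j].1 *
        positionCount w ρ ν p (bigAnd (inclusionExclusion φs)[j].2) := by
  classical
  simp only [positionCount, Finset.card_filter, Nat.cast_sum, Nat.cast_ite, Nat.cast_one,
    Nat.cast_zero, Finset.mul_sum]
  rw [Finset.sum_comm]
  refine Finset.sum_congr rfl fun i _ => ?_
  rw [indicator_bigOr]
  exact (Fin.sum_univ_fun_getElem (inclusionExclusion φs) _).symm

end FOC

/-- **Lemma (distributing a counting quantifier over a disjunction).**
Any formula `∃^{=x}p. ⋁ᵢ φᵢ` is equivalent to
`∃x₁.…∃xₘ.(⋀ⱼ ∃^{=xⱼ}p. ψⱼ ∧ χ)` where the `xⱼ` are fresh count variables,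
each `ψⱼ` is a conjunction of a subset of the `φᵢ`, and `χ` has no free
position variables. -/
theorem distribute_counting_quantifier {A : Type}
    (x pv : ℕ) (φs : List (FOC.Formula A)) :
    ∃ (m : ℕ) (xs : Fin m → ℕ) (ψ : Fin m → FOC.Formula A) (χ : FOC.Formula A),
      Function.Injective xs ∧
      (∀ j, xs j ∉ FOC.freeCount (FOC.Formula.cnt x pv (FOC.bigOr φs))) ∧
      (∀ j, ∃ l : List (FOC.Formula A), l.Sublist φs ∧ ψ j = FOC.bigAnd l) ∧
      FOC.freePos χ = ∅ ∧
      FOC.FOCEquiv (FOC.Formula.cnt x pv (FOC.bigOr φs))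
        (FOC.exCs (List.ofFn xs)
          (FOC.Formula.and
            (FOC.bigAnd (List.ofFn fun j => FOC.Formula.cnt (xs j) pv (ψ j))) χ)) := by
  set K := FOC.inclusionExclusion φs
  set F := FOC.freeCount (FOC.Formula.cnt x pv (FOC.bigOr φs))
  let xs : Fin K.length → ℕ := fun j => F.sup id + 1 + j
  have xs_inj : Function.Injective xs := fun i j h => Fin.ext (Nat.add_left_cancel h)
  have xs_fresh (j : Fin K.length) : xs j ∉ F := fun h => by
    have : xs j ≤ F.sup id := Finset.le_sup (f := id) h
    grind
  have sublist (j : Fin K.length) : K[j].2.Sublist φs :=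
    FOC.sublist_of_mem_inclusionExclusion (List.getElem_mem j.2)
  have x_mem : x ∈ F := Finset.mem_union_right _ (Finset.mem_singleton_self x)
  have count_eq (w : List A) (ρ : ℕ → ℕ) {ν ν' : ℕ → ℚ} (h : ∀ y ∈ F, ν' y = ν y)
      (j : Fin K.length) : FOC.positionCount w ρ ν' pv (FOC.bigAnd K[j].2) =
        FOC.positionCount w ρ ν pv (FOC.bigAnd K[j].2) :=
    FOC.positionCount_congr w ρ pv _ fun y hy =>
      h y (Finset.mem_union_left _ (FOC.freeCount_bigAnd_subset (sublist j) hy))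
  refine ⟨K.length, xs, fun j => FOC.bigAnd K[j].2,
    .eq (.var x) ⟨0, List.ofFn fun j => (K[j].1, xs j)⟩, xs_inj, xs_fresh,
    fun j => ⟨_, sublist j, rfl⟩, rfl, fun w ρ ν => ?_⟩
  have sat_body (ν' : ℕ → ℚ) : FOC.Sat w ρ ν' (.and
      (FOC.bigAnd (List.ofFn fun j => .cnt (xs j) pv (FOC.bigAnd K[j].2)))
      (.eq (.var x) ⟨0, List.ofFn fun j => (K[j].1, xs j)⟩)) ↔
      (∀ j, FOC.positionCount w ρ ν' pv (FOC.bigAnd K[j].2) = ν' (xs j)) ∧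
        ν' x = ∑ j, K[j].1 * ν' (xs j) := by
    refine and_congr ?_ ?_
    · simp only [FOC.sat_bigAnd, List.forall_mem_ofFn_iff, FOC.sat_cnt]
    · simp [FOC.Sat, FOC.CTerm.eval, FOC.CTerm.var, List.map_ofFn, List.sum_ofFn]
  simp only [FOC.sat_exCs, sat_body]
  rw [FOC.sat_cnt, FOC.positionCount_bigOr]
  constructor
  · intro h
    set c : Fin K.length → ℚ := fun j => FOC.positionCount w ρ ν pv (FOC.bigAnd K[j].2)
    have agree (y : ℕ) (hy : ¬ ∃ j, xs j = y) : Function.extend xs c ν y = ν y :=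
      Function.extend_apply' _ _ _ hy
    have agree_F (y : ℕ) (hy : y ∈ F) : Function.extend xs c ν y = ν y :=
      agree y fun ⟨j, hj⟩ => xs_fresh j (hj ▸ hy)
    refine ⟨Function.extend xs c ν, fun y hy => agree y ?_, fun j => ?_, ?_⟩
    · simpa [List.mem_ofFn] using hy
    · rw [xs_inj.extend_apply, count_eq w ρ agree_F]
    · simp only [xs_inj.extend_apply, agree_F x x_mem]
      exact h.symm
  · rintro ⟨ν', agree, hcount, hx⟩
    have agree_F (y : ℕ) (hy : y ∈ F) : ν' y = ν y := by
      refine agree y fun hmem => ?_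
      obtain ⟨j, rfl⟩ := List.mem_ofFn.1 hmem
      exact xs_fresh j hy
    rw [← agree_F x x_mem, hx]
    exact Finset.sum_congr rfl fun j _ => by rw [← hcount j, count_eq w ρ agree_F]
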